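/- arXiv:2007.12815 — 2 statements merged into one kernel-verified Lean document; each statement's English description precedes it below -/
import Mathlib

section
/- For every β ∈ [0,1], every real R > 0, every real h, and every natural number D, there exists a real polynomial P of degree at most D such that for all x ∈ [−1,1], | f_β(Rx + h) − P(x) | ≤ 4R(1 + 2R) · (1 + 1/(2R))^{−D}, where f_β(t) := (1/β) arctanh(β tanh(t)) for β ∈ (0,1] and f₀ := tanh. -/
open Real Polynomial

/-- `arctanh x = (1/2) log((1+x)/(1-x))`, the inverse hyperbolic tangent. -/
noncomputable def arctanh (x : ℝ) : ℝ := (1 / 2) * Real.log ((1 + x) / (1 - x))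

/-- The family of activations `f_β(t) = (1/β) arctanh (β tanh t)` for `β ∈ (0,1]`,
with `f_0 = tanh`. -/
noncomputable def fAct (β : ℝ) (t : ℝ) : ℝ :=
  if β = 0 then Real.tanh t else (1 / β) * arctanh (β * Real.tanh t)

noncomputable def FC (β : ℝ) (z : ℂ) : ℂ :=
  if β = 0 then Complex.tanh z else
    (1 / (2 * β)) * (Complex.log (1 + β * Complex.tanh z) - Complex.log (1 - β * Complex.tanh z))

lemma FC_ofReal (β : ℝ) (hβ0 : 0 ≤ β) (hβ1 : β ≤ 1) (t : ℝ) : (FC β t).re = fAct β t := by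
  unfold FC fAct arctanh
  split_ifs with hb
  · rw [← Complex.ofReal_tanh, Complex.ofReal_re]
  · have h1 := Real.tanh_lt_one t
    have h2 := Real.neg_one_lt_tanh t
    have hb' : 0 < β := lt_of_le_of_ne hβ0 (Ne.symm hb)
    have h3 : 0 < 1 + β * Real.tanh t := by nlinarith
    have h4 : 0 < 1 - β * Real.tanh t := by nlinarith
    have e : (1 / (2 * β)) * (Complex.log (1 + β * Complex.tanh t) - Complex.log (1 - β * Complex.tanh t))
      = ((1 / (2 * β) * (Real.log (1 + β * Real.tanh t) - Real.log (1 - β * Real.tanh t)) : ℝ) : ℂ) := by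
      push_cast [Complex.ofReal_log h3.le, Complex.ofReal_log h4.le]
      rfl
    rw [e, Complex.ofReal_re, Real.log_div h3.ne' h4.ne']
    field_simp

lemma cosh_sq_re (z : ℂ) (hz : |z.im| ≤ 1 / 2) : 1 / 2 < (Complex.cosh z ^ 2).re := by
  have h1 : Complex.cosh z ^ 2 = (1 + Complex.cosh (2 * z)) / 2 := by
    rw [Complex.cosh_two_mul, Complex.sinh_sq]; ring
  have h2 : (Complex.cosh (2 * z)).re = Real.cosh (2 * z.re) * Real.cos (2 * z.im) := by
    have : 2 * z = ((2 * z.re : ℝ) : ℂ) + ((2 * z.im : ℝ) : ℂ) * Complex.I := by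
      apply Complex.ext <;> simp
    rw [this, Complex.cosh_add, Complex.cosh_mul_I, Complex.sinh_mul_I, ← Complex.ofReal_cosh,
      ← Complex.ofReal_cos, ← Complex.ofReal_sin, ← Complex.ofReal_sinh]
    simp only [Complex.add_re, Complex.mul_re, Complex.mul_im, Complex.ofReal_re, Complex.ofReal_im,
      Complex.I_re, Complex.I_im]
    ring
  have h3 : 0 < Real.cos (2 * z.im) := by
    have := abs_le.1 hz
    have := Real.pi_gt_three
    apply Real.cos_pos_of_mem_Ioo
    constructor <;> linarith
  have h4 := mul_pos (Real.cosh_pos (2 * z.re)) h3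
  rw [← h2] at h4
  rw [h1]
  have : ((1 + Complex.cosh (2 * z)) / 2).re = (1 + (Complex.cosh (2 * z)).re) / 2 := by
    simp
  rw [this]; linarith

lemma norm_tanh_lt (z : ℂ) (hz : |z.im| ≤ 1 / 2) : ‖Complex.tanh z‖ < 1 := by
  have h := cosh_sq_re z hz
  have hc : Complex.cosh z ≠ 0 := by
    intro h0; rw [h0] at h; norm_num at h
  have e1 : Complex.cosh z = Real.cosh z.re * Real.cos z.im + Real.sinh z.re * Real.sin z.im * Complex.I := by
    conv_lhs => rw [← Complex.re_add_im z]
    rw [Complex.cosh_add, Complex.cosh_mul_I, Complex.sinh_mul_I]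
    push_cast; ring
  have e2 : Complex.sinh z = Real.sinh z.re * Real.cos z.im + Real.cosh z.re * Real.sin z.im * Complex.I := by
    conv_lhs => rw [← Complex.re_add_im z]
    rw [Complex.sinh_add, Complex.cosh_mul_I, Complex.sinh_mul_I]
    push_cast; ring
  have h3 : Real.sin z.im ^ 2 < Real.cos z.im ^ 2 := by
    have h3 : 0 < Real.cos (2 * z.im) := by
      have := abs_le.1 hz
      have := Real.pi_gt_three
      apply Real.cos_pos_of_mem_Ioo
      constructor <;> linarith
    rw [Real.cos_two_mul'] at h3
    linarith
  rw [Complex.tanh_eq_sinh_div_cosh, norm_div, div_lt_one (norm_pos_iff.2 hc)]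
  apply lt_of_pow_lt_pow_left₀ 2 (norm_nonneg _)
  rw [← Complex.normSq_eq_norm_sq, ← Complex.normSq_eq_norm_sq, e1, e2, ← Complex.ofReal_mul,
    ← Complex.ofReal_mul, ← Complex.ofReal_mul, ← Complex.ofReal_mul, Complex.normSq_add_mul_I,
    Complex.normSq_add_mul_I]
  have := Real.cosh_sq z.re
  nlinarith

lemma FC_deriv (β : ℝ) (hβ0 : 0 ≤ β) (hβ1 : β ≤ 1) (z : ℂ) (hz : |z.im| ≤ 1 / 2) :
    HasDerivAt (FC β) (1 / (Complex.cosh z ^ 2 - β ^ 2 * Complex.sinh z ^ 2)) z := by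
  have h := cosh_sq_re z hz
  have hc : Complex.cosh z ≠ 0 := by
    intro h0; rw [h0] at h; norm_num at h
  have ht : HasDerivAt Complex.tanh (1 / Complex.cosh z ^ 2) z := by
    have h1 := (Complex.hasDerivAt_sinh z).div (Complex.hasDerivAt_cosh z) hc
    have h2 : Complex.tanh = fun z => Complex.sinh z / Complex.cosh z := by
      ext z; exact Complex.tanh_eq_sinh_div_cosh z
    rw [h2]
    refine HasDerivAt.congr_deriv h1 ?_
    congr 1
    rw [← sq, ← sq, Complex.cosh_sq]; ring
  by_cases hb : β = 0
  · have : FC β = Complex.tanh := by ext z; simp [FC, hb]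
    rw [this]; convert ht using 2; simp [hb]
  · have hn : ‖(β : ℂ) * Complex.tanh z‖ < 1 := by
      rw [norm_mul, Complex.norm_real, Real.norm_of_nonneg hβ0]
      nlinarith [norm_tanh_lt z hz, norm_nonneg (Complex.tanh z)]
    have hre := (Complex.abs_re_le_norm _).trans_lt hn
    rw [abs_lt] at hre
    have s1 : 1 + β * Complex.tanh z ∈ Complex.slitPlane := by
      left; simp only [Complex.add_re, Complex.one_re]; linarith
    have s2 : 1 - β * Complex.tanh z ∈ Complex.slitPlane := by
      left; simp only [Complex.sub_re, Complex.one_re]; linarith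
    have d1 := ((ht.const_mul (β : ℂ)).const_add 1).clog s1
    have d2 := ((ht.const_mul (β : ℂ)).const_sub 1).clog s2
    have d3 := (d1.sub d2).const_mul (1 / (2 * (β : ℂ)))
    have : FC β = fun z => (1 / (2 * β)) * (Complex.log (1 + β * Complex.tanh z) - Complex.log (1 - β * Complex.tanh z)) := by
      ext z; simp [FC, hb]
    rw [this]
    refine HasDerivAt.congr_deriv d3 (Eq.symm ?_)
    have n1 := Complex.slitPlane_ne_zero s1
    have n2 := Complex.slitPlane_ne_zero s2
    have hb' : (β : ℂ) ≠ 0 := by exact_mod_cast hb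
    have e : Complex.cosh z ^ 2 - β ^ 2 * Complex.sinh z ^ 2 =
        Complex.cosh z ^ 2 * ((1 + β * Complex.tanh z) * (1 - β * Complex.tanh z)) := by
      rw [Complex.tanh_eq_sinh_div_cosh]; field_simp; ring
    rw [e]
    field_simp
    ring

lemma FC_deriv_norm (β : ℝ) (hβ0 : 0 ≤ β) (hβ1 : β ≤ 1) (z : ℂ) (hz : |z.im| ≤ 1 / 2) :
    ‖1 / (Complex.cosh z ^ 2 - β ^ 2 * Complex.sinh z ^ 2)‖ ≤ 2 := by
  have h := cosh_sq_re z hz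
  have e : Complex.cosh z ^ 2 - β ^ 2 * Complex.sinh z ^ 2 =
      ((1 - β ^ 2 : ℝ) : ℂ) * Complex.cosh z ^ 2 + ((β ^ 2 : ℝ) : ℂ) := by
    rw [Complex.sinh_sq]; push_cast; ring
  have h2 : 1 / 2 ≤ (Complex.cosh z ^ 2 - β ^ 2 * Complex.sinh z ^ 2).re := by
    rw [e, Complex.add_re, Complex.re_ofReal_mul, Complex.ofReal_re]
    have : 0 ≤ 1 - β ^ 2 := by nlinarith
    nlinarith
  have h3 := h2.trans ((le_abs_self _).trans (Complex.abs_re_le_norm _))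
  rw [norm_div, norm_one, div_le_iff₀ (by linarith)]
  linarith

lemma FC_lip (β : ℝ) (hβ0 : 0 ≤ β) (hβ1 : β ≤ 1) (z w : ℂ) (hz : |z.im| ≤ 1 / 2)
    (hw : |w.im| ≤ 1 / 2) : ‖FC β w - FC β z‖ ≤ 2 * ‖w - z‖ := by
  have hconv : Convex ℝ {z : ℂ | |z.im| ≤ 1 / 2} := by
    have : {z : ℂ | |z.im| ≤ 1 / 2} = Complex.imLm ⁻¹' Set.Icc (-(1/2)) (1/2) := by
      ext z; simp [abs_le]
    rw [this]
    exact (convex_Icc _ _).linear_preimage _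
  exact hconv.norm_image_sub_le_of_norm_hasDerivWithin_le
    (fun x hx => (FC_deriv β hβ0 hβ1 x hx).hasDerivWithinAt)
    (fun x hx => FC_deriv_norm β hβ0 hβ1 x hx) hz hw

lemma jouk_im (R : ℝ) (hR : 0 < R) (h : ℝ) (ζ : ℂ) (h1 : 1 ≤ ‖ζ‖) (h2 : ‖ζ‖ ≤ 1 + 1 / (2 * R)) :
    |((h : ℂ) + R * ((ζ + ζ⁻¹) / 2)).im| ≤ 1 / 2 := by
  have e : ((h : ℂ) + R * ((ζ + ζ⁻¹) / 2)).im = R / 2 * (ζ.im * (1 - 1 / ‖ζ‖ ^ 2)) := by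
    rw [Complex.add_im, Complex.ofReal_im, Complex.im_ofReal_mul]
    have : ((ζ + ζ⁻¹) / 2).im = (ζ.im + ζ⁻¹.im) / 2 := by simp
    rw [this, Complex.inv_im, Complex.normSq_eq_norm_sq]
    ring
  have hp : 0 < ‖ζ‖ := by linarith
  have h3 : 0 ≤ 1 - 1 / ‖ζ‖ ^ 2 := by
    rw [sub_nonneg, div_le_one (by positivity)]; nlinarith
  rw [e, abs_mul, abs_mul, abs_of_pos (by positivity : 0 < R / 2), abs_of_nonneg h3]
  have h4 : |ζ.im| * (1 - 1 / ‖ζ‖ ^ 2) ≤ ‖ζ‖ * (1 - 1 / ‖ζ‖ ^ 2) := by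
    gcongr; exact Complex.abs_im_le_norm ζ
  have h5 : ‖ζ‖ * (1 - 1 / ‖ζ‖ ^ 2) ≤ 2 * (‖ζ‖ - 1) := by
    have : ‖ζ‖ * (1 - 1 / ‖ζ‖ ^ 2) = ‖ζ‖ - 1 / ‖ζ‖ := by field_simp
    rw [this]
    have : 2 - ‖ζ‖ ≤ 1 / ‖ζ‖ := by rw [le_div_iff₀ hp]; nlinarith [sq_nonneg (‖ζ‖ - 1)]
    linarith
  calc _ ≤ R / 2 * (2 * (1 / (2 * R))) := by
        apply mul_le_mul_of_nonneg_left _ (by positivity); linarith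
    _ = 1 / 2 := by field_simp

lemma ell_coeff (G : ℂ → ℂ) (ρ M : ℝ) (hρ : 1 < ρ)
    (hd : ∀ ζ : ℂ, 1 ≤ ‖ζ‖ → ‖ζ‖ ≤ ρ → DifferentiableAt ℂ G ζ)
    (hM : ∀ ζ : ℂ, ‖ζ‖ = ρ → ‖G ζ‖ ≤ M) (n : ℕ)
    (c : ℂ) (hc : c = (1 / (2 * π) : ℝ) • ∫ θ in (0:ℝ)..(2 * π),
      Complex.exp (-(n * θ * Complex.I)) * G (Complex.exp (θ * Complex.I))) :
    ‖c‖ ≤ M * (ρ⁻¹) ^ n := by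
  have hρ0 : 0 < ρ := by linarith
  have key := Complex.circleIntegral_sub_center_inv_smul_eq_of_differentiable_on_annulus_off_countable
    (c := 0) (r := 1) (R := ρ) one_pos hρ.le (f := fun z => (z ^ n)⁻¹ * G z) Set.countable_empty
    (by
      intro z hz
      simp only [Set.mem_sdiff, Metric.mem_closedBall, Metric.mem_ball, dist_zero_right, not_lt] at hz
      have hz0 : z ≠ 0 := by
        rintro rfl; simp at hz; linarith [hz.2]
      have := (hd z hz.2 hz.1)
      have h2 : DifferentiableAt ℂ (fun z : ℂ => (z ^ n)⁻¹ * G z) z :=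
        ((differentiableAt_id.pow n).inv (pow_ne_zero _ hz0)).mul this
      exact h2.continuousAt.continuousWithinAt)
    (by
      intro z hz
      simp only [Set.mem_sdiff, Metric.mem_closedBall, Metric.mem_ball, dist_zero_right, not_le] at hz
      have hz0 : z ≠ 0 := by
        rintro rfl; simp at hz; linarith [hz.2]
      have := (hd z hz.1.2.le hz.1.1.le)
      exact ((differentiableAt_id.pow n).inv (pow_ne_zero _ hz0)).mul this)
  have h1 : (∮ z in C(0, 1), (z - 0)⁻¹ • ((z ^ n)⁻¹ * G z)) = Complex.I * ∫ θ in (0:ℝ)..(2 * π),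
      Complex.exp (-(n * θ * Complex.I)) * G (Complex.exp (θ * Complex.I)) := by
    rw [circleIntegral, ← intervalIntegral.integral_const_mul]
    congr 1
    ext θ
    simp only [deriv_circleMap, circleMap, Complex.ofReal_one, one_mul, zero_add, sub_zero, smul_eq_mul]
    rw [Complex.exp_neg, mul_assoc (n : ℂ), Complex.exp_nat_mul]
    have := Complex.exp_ne_zero (θ * Complex.I)
    field_simp
  have h2 : ‖∮ z in C(0, ρ), (z - 0)⁻¹ • ((z ^ n)⁻¹ * G z)‖ ≤ 2 * π * ρ * (ρ⁻¹ * ((ρ^n)⁻¹ * M)) := by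
    apply circleIntegral.norm_integral_le_of_norm_le_const hρ0.le
    intro z hz
    have hz : ‖z‖ = ρ := by simpa using hz
    simp only [sub_zero, smul_eq_mul, norm_mul, norm_inv, norm_pow, hz]
    gcongr
    exact hM z hz
  rw [key, h1, norm_mul, Complex.norm_I, one_mul] at h2
  rw [hc, norm_smul, Real.norm_of_nonneg (by positivity)]
  calc _ ≤ (1 / (2 * π)) * (2 * π * ρ * (ρ⁻¹ * ((ρ^n)⁻¹ * M))) := by gcongr
    _ = _ := by have := pi_pos; field_simp; simp; field_simp

lemma bern (G : ℂ → ℂ) (ρ M : ℝ) (hρ : 1 < ρ)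
    (hd : ∀ ζ : ℂ, 1 ≤ ‖ζ‖ → ‖ζ‖ ≤ ρ → DifferentiableAt ℂ G ζ)
    (hs : ∀ ζ : ℂ, ‖ζ‖ = 1 → G ζ⁻¹ = G ζ)
    (hM : ∀ ζ : ℂ, ‖ζ‖ = ρ → ‖G ζ‖ ≤ M) (D : ℕ) :
    ∃ P : Polynomial ℝ, P.natDegree ≤ D ∧ ∀ θ : ℝ,
      |(G (Complex.exp (θ * Complex.I))).re - P.eval (Real.cos θ)| ≤ 2 * M / (ρ - 1) * (ρ ^ D)⁻¹ := by
  have hρ0 : 0 < ρ := by linarith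
  have : Fact (0 < 2 * π) := ⟨two_pi_pos⟩
  let f : C(AddCircle (2 * π), ℂ) := ⟨fun x => G (AddCircle.toCircle x : ℂ), by
    rw [continuous_iff_continuousAt]
    intro x
    have h1 : ContinuousAt G (AddCircle.toCircle x : ℂ) :=
      (hd _ (Circle.norm_coe _).ge ((Circle.norm_coe _).trans_le hρ.le)).continuousAt
    exact ContinuousAt.comp (f := fun x : AddCircle (2 * π) => (AddCircle.toCircle x : ℂ)) h1
      (by fun_prop)⟩
  have hf (θ : ℝ) : f (θ : AddCircle (2 * π)) = G (Complex.exp (θ * Complex.I)) := by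
    simp only [f, ContinuousMap.coe_mk, AddCircle.toCircle_apply_mk]
    rw [div_self (by positivity), one_mul, Circle.coe_exp]
  have hfou (n : ℤ) (θ : ℝ) : fourier n (θ : AddCircle (2 * π)) = Complex.exp (n * θ * Complex.I) := by
    rw [fourier_coe_apply]
    congr 1
    have : (π : ℂ) ≠ 0 := by exact_mod_cast pi_ne_zero
    push_cast
    field_simp
  have hev (n : ℤ) : fourierCoeff f (-n) = fourierCoeff f n := by
    unfold fourierCoeff
    rw [← MeasureTheory.integral_neg_eq_self]
    congr 1
    ext t
    congr 1
    · simp [fourier_apply]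
    · simp only [f, ContinuousMap.coe_mk, AddCircle.toCircle_neg, Circle.coe_inv]
      exact hs _ (Circle.norm_coe _)
  have hcn (n : ℕ) : ‖fourierCoeff f n‖ ≤ M * (ρ⁻¹) ^ n := by
    apply ell_coeff G ρ M hρ hd hM n
    rw [fourierCoeff_eq_intervalIntegral f n 0, zero_add]
    congr 1
    apply intervalIntegral.integral_congr
    intro θ _
    simp only [hf, hfou, smul_eq_mul]
    congr 2
    push_cast
    ring
  have hr : ρ⁻¹ < 1 := inv_lt_one_of_one_lt₀ hρ
  have hgeo := hasSum_geometric_of_lt_one (inv_nonneg.2 hρ0.le) hr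
  have hsum : Summable (fourierCoeff f) := by
    have h0 : Summable (fun n : ℕ => fourierCoeff f n) :=
      Summable.of_norm_bounded (hgeo.summable.mul_left M) hcn
    exact Summable.of_nat_of_neg h0 (by simpa only [hev] using h0)
  refine ⟨∑ k ∈ Finset.range (D + 1), C ((if k = 0 then 1 else 2) * (fourierCoeff f k).re) * Chebyshev.T ℝ k, ?_, ?_⟩
  · apply Polynomial.natDegree_sum_le_of_forall_le
    intro k hk
    refine (Polynomial.natDegree_C_mul_le _ _).trans ?_
    rw [Chebyshev.natDegree_T]
    simp at hk ⊢
    omega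
  intro θ
  have H := (has_pointwise_sum_fourier_series_of_summable hsum (θ : AddCircle (2 * π))).nat_add_neg
  have H2 := (hasSum_nat_add_iff' (D + 1)).2 H
  have hB : HasSum (fun n : ℕ => 2 * M * (ρ⁻¹) ^ (D + 1) * (ρ⁻¹) ^ n) (2 * M * (ρ⁻¹) ^ (D + 1) * (1 - ρ⁻¹)⁻¹) :=
    hgeo.mul_left _
  have H3 := H2.norm_le_of_bounded hB (by
    intro n
    refine (norm_add_le _ _).trans ?_
    rw [hev, norm_smul, norm_smul]
    have h1 (m : ℤ) : ‖fourier m (θ : AddCircle (2 * π))‖ = 1 := by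
      rw [fourier_apply]; exact Circle.norm_coe _
    rw [h1, h1]
    have := hcn (n + (D + 1))
    rw [pow_add] at this
    linarith)
  refine ((Complex.abs_re_le_norm _).trans' ?_).trans (H3.trans_eq ?_)
  · apply le_of_eq
    congr 1
    rw [hf]
    simp only [Complex.sub_re, Complex.add_re, Complex.re_sum, eval_finsetSum, eval_mul, eval_C, Chebyshev.T_real_cos]
    rw [Finset.sum_range_succ', Finset.sum_range_succ' (n := D)]
    have e : ∀ k : ℕ, (fourierCoeff f ((k + 1 : ℕ) : ℤ) • fourier ((k + 1 : ℕ) : ℤ) (θ : AddCircle (2 * π))).re +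
       (fourierCoeff f (-((k + 1 : ℕ) : ℤ)) • fourier (-((k + 1 : ℕ) : ℤ)) (θ : AddCircle (2 * π))).re
       = 2 * (fourierCoeff f ((k + 1 : ℕ) : ℤ)).re * Real.cos (((k + 1 : ℕ) : ℤ) * θ) := by
      intro k
      rw [hev, hfou, hfou]
      generalize ((k + 1 : ℕ) : ℤ) = m
      generalize fourierCoeff f m = c
      have e1 : Complex.exp (m * θ * Complex.I) = Real.cos (m * θ) + Real.sin (m * θ) * Complex.I := by
        rw [Complex.exp_mul_I]; push_cast; rfl
      have e2 : Complex.exp ((-m : ℤ) * θ * Complex.I) = Real.cos (m * θ) - Real.sin (m * θ) * Complex.I := by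
        push_cast
        rw [Complex.exp_mul_I, neg_mul, Complex.cos_neg, Complex.sin_neg]; ring
      rw [e1, e2]
      simp only [smul_eq_mul, Complex.mul_re, Complex.add_re, Complex.sub_re, Complex.add_im, Complex.sub_im, Complex.ofReal_re, Complex.ofReal_im, Complex.I_re, Complex.I_im, Complex.mul_im]
      ring
    simp only [e]
    simp
    ring
  · have : ρ - 1 ≠ 0 := by linarith
    rw [pow_succ, inv_pow]
    have h3 : 1 - ρ⁻¹ = (ρ - 1) / ρ := by field_simp
    rw [h3]
    field_simp

/-- **Lemma (uniform polynomial approximation of the activations).** For every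
`β ∈ [0,1]`, every `R > 0`, every shift `h` and degree `D`, there is a polynomial `P`
of degree at most `D` with
`|f_β (R x + h) − P(x)| ≤ 4R(1 + 2R)·(1 + 1/(2R))^{−D}` for all `x ∈ [−1,1]`. -/
theorem fAct_poly_approx (β : ℝ) (hβ0 : 0 ≤ β) (hβ1 : β ≤ 1)
    (R : ℝ) (hR : 0 < R) (h : ℝ) (D : ℕ) :
    ∃ P : Polynomial ℝ, P.natDegree ≤ D ∧
      ∀ x ∈ Set.Icc (-1 : ℝ) 1,
        |fAct β (R * x + h) - P.eval x| ≤
          4 * R * (1 + 2 * R) * ((1 + 1 / (2 * R)) ^ D)⁻¹ := by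
  have hs : 0 < 1 / (2 * R) := by positivity
  obtain ⟨P, hP, hPe⟩ := bern (fun ζ => FC β ((h : ℂ) + R * ((ζ + ζ⁻¹) / 2)) - FC β h)
    (1 + 1 / (2 * R)) (1 + 2 * R) (by linarith)
    (by
      intro ζ h1 h2
      have hz0 : ζ ≠ 0 := by
        rintro rfl; simp at h1; linarith
      have hF := (FC_deriv β hβ0 hβ1 _ (jouk_im R hR h ζ h1 h2)).differentiableAt
      have hJ : DifferentiableAt ℂ (fun ζ : ℂ => (h : ℂ) + R * ((ζ + ζ⁻¹) / 2)) ζ := by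
        fun_prop (disch := assumption)
      exact (DifferentiableAt.comp ζ hF hJ).sub_const _)
    (by
      intro ζ _
      simp only [inv_inv, add_comm])
    (by
      intro ζ hζ
      have h1 : 1 ≤ ‖ζ‖ := by linarith
      refine (FC_lip β hβ0 hβ1 _ _ (by simp) (jouk_im R hR h ζ h1 hζ.le)).trans ?_
      rw [add_sub_cancel_left, norm_mul, Complex.norm_real, Real.norm_of_nonneg hR.le, norm_div, Complex.norm_two]
      have h3 : ‖ζ + ζ⁻¹‖ ≤ 2 * (1 + 1 / (2 * R)) := by
        refine (norm_add_le _ _).trans ?_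
        rw [norm_inv]
        have := inv_le_one_of_one_le₀ h1
        linarith
      calc _ ≤ 2 * (R * (2 * (1 + 1 / (2 * R)) / 2)) := by gcongr
        _ = _ := by field_simp; ring) D
  refine ⟨P + C (fAct β h), ?_, ?_⟩
  · rwa [Polynomial.natDegree_add_C]
  · intro x hx
    have := hPe (Real.arccos x)
    rw [Real.cos_arccos hx.1 hx.2] at this
    have e : (Complex.exp (Real.arccos x * Complex.I) + (Complex.exp (Real.arccos x * Complex.I))⁻¹) / 2 = x := by
      rw [← Complex.exp_neg, ← neg_mul, ← Complex.cos, ← Complex.ofReal_cos, Real.cos_arccos hx.1 hx.2]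
    simp only [e] at this
    rw [Complex.sub_re, FC_ofReal β hβ0 hβ1, show (h : ℂ) + R * x = ((R * x + h : ℝ) : ℂ) by push_cast; ring, FC_ofReal β hβ0 hβ1] at this
    rw [eval_add, eval_C, show fAct β (R * x + h) - (P.eval x + fAct β h) = fAct β (R * x + h) - fAct β h - P.eval x by ring]
    refine this.trans_eq ?_
    field_simp
    ring
end

section
/- Let n, D be positive integers, w ∈ ℝⁿ, and a₀, a₁, …, a_D real numbers. Let p be the multivariate real polynomial in variables x₁, …, x_n given by p(x) = Σ_{i=0}^{D} a_i (w · x)^i, where w · x = Σ_{k=1}^n w_k x_k, and write p(x) = Σ_α u_α x^α as a sum of monomials with coefficients u_α (α ranging over multi-indices of degree at most D). Then Σ_α |u_α| ≤ √(Σ_{i=0}^{D} a_i²) · (1 + ‖w‖₁)^{D}, where ‖w‖₁ = Σ_k |w_k|. -/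
/-- All finite partial sums of absolute values of coefficients are at most `c`. -/
def CoeffBd {n : ℕ} (p : MvPolynomial (Fin n) ℝ) (c : ℝ) : Prop :=
  ∀ S : Finset (Fin n →₀ ℕ), ∑ α ∈ S, |MvPolynomial.coeff α p| ≤ c

theorem CoeffBd.sum {n : ℕ} {ι : Type*} (s : Finset ι) (f : ι → MvPolynomial (Fin n) ℝ) (c : ι → ℝ)
    (h : ∀ i ∈ s, CoeffBd (f i) (c i)) : CoeffBd (∑ i ∈ s, f i) (∑ i ∈ s, c i) := by
  intro S
  calc ∑ α ∈ S, |MvPolynomial.coeff α (∑ i ∈ s, f i)|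
      ≤ ∑ α ∈ S, ∑ i ∈ s, |MvPolynomial.coeff α (f i)| := by
        refine Finset.sum_le_sum fun α _ => ?_
        rw [MvPolynomial.coeff_sum]
        exact Finset.abs_sum_le_sum_abs _ _
    _ = ∑ i ∈ s, ∑ α ∈ S, |MvPolynomial.coeff α (f i)| := Finset.sum_comm
    _ ≤ _ := Finset.sum_le_sum fun i hi => h i hi S

theorem CoeffBd.monomial {n : ℕ} (m : Fin n →₀ ℕ) (r : ℝ) :
    CoeffBd (MvPolynomial.monomial m r) |r| := by
  classical
  intro S
  simp only [MvPolynomial.coeff_monomial, apply_ite abs, abs_zero, Finset.sum_ite_eq]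
  split_ifs
  · exact le_rfl
  · exact abs_nonneg r

theorem CoeffBd.mul {n : ℕ} {p q : MvPolynomial (Fin n) ℝ} {c d : ℝ}
    (hp : CoeffBd p c) (hq : CoeffBd q d) : CoeffBd (p * q) (c * d) := by
  have hc : 0 ≤ c := by simpa using hp ∅
  have key : CoeffBd (p * q) (∑ a ∈ p.support, ∑ b ∈ q.support,
      |MvPolynomial.coeff a p * MvPolynomial.coeff b q|) := by
    have e : p * q = ∑ a ∈ p.support, ∑ b ∈ q.support,
        MvPolynomial.monomial (a + b) (MvPolynomial.coeff a p * MvPolynomial.coeff b q) := by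
      conv_lhs => rw [p.as_sum, q.as_sum, Finset.sum_mul_sum]
      simp only [MvPolynomial.monomial_mul]
    rw [e]
    exact CoeffBd.sum _ _ _ fun a _ => CoeffBd.sum _ _ _ fun b _ => CoeffBd.monomial _ _
  intro S
  refine (key S).trans ?_
  simp only [abs_mul]
  rw [← Finset.sum_mul_sum]
  exact mul_le_mul (hp _) (hq _) (Finset.sum_nonneg fun _ _ => abs_nonneg _) hc

theorem CoeffBd.pow {n : ℕ} {p : MvPolynomial (Fin n) ℝ} {c : ℝ}
    (hp : CoeffBd p c) (k : ℕ) : CoeffBd (p ^ k) (c ^ k) := by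
  induction k with
  | zero => simpa using CoeffBd.monomial (n := n) 0 1
  | succ k ih => rw [pow_succ, pow_succ]; exact ih.mul hp

theorem geom_sq_bound (W : ℝ) (hW : 0 ≤ W) (D : ℕ) :
    ∑ i : Fin (D + 1), (W ^ (i : ℕ)) ^ 2 ≤ ((1 + W) ^ D) ^ 2 := by
  rw [Fin.sum_univ_eq_sum_range (fun i => (W ^ i) ^ 2)]
  induction D with
  | zero => simp
  | succ D ih =>
    rw [Finset.sum_range_succ]
    have h1 : (W ^ D) ^ 2 ≤ ((1 + W) ^ D) ^ 2 := by
      gcongr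
      linarith
    have h2 : 0 ≤ W * ((1 + W) ^ D) ^ 2 := by positivity
    have h3 := mul_le_mul_of_nonneg_left h1 (sq_nonneg W)
    calc _ ≤ ((1 + W) ^ D) ^ 2 + W ^ 2 * (W ^ D) ^ 2 := by
          rw [pow_succ W D, mul_pow, mul_comm (W ^ 2)]
          linarith
      _ ≤ ((1 + W) ^ D) ^ 2 * (1 + W) ^ 2 := by nlinarith
      _ = _ := by ring

/-- **Lemma (ℓ¹-norm of multinomial expansion coefficients).** If
`p(x) = ∑_{i=0}^{D} a_i (w · x)^i` is expanded as `∑_α u_α x^α`, then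
`∑_α |u_α| ≤ √(∑_i a_i²) · (1 + ‖w‖₁)^D`. -/
theorem mv_coeff_l1_bound {n D : ℕ} (hn : 0 < n) (hD : 0 < D)
    (w : Fin n → ℝ) (a : Fin (D + 1) → ℝ) :
    (∑ α ∈ (∑ i : Fin (D + 1),
        MvPolynomial.C (a i) * (∑ k : Fin n, MvPolynomial.C (w k) * MvPolynomial.X k) ^ (i : ℕ)).support,
      |MvPolynomial.coeff α
        (∑ i : Fin (D + 1),
          MvPolynomial.C (a i) * (∑ k : Fin n, MvPolynomial.C (w k) * MvPolynomial.X k) ^ (i : ℕ))|) ≤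
      Real.sqrt (∑ i : Fin (D + 1), a i ^ 2) * (1 + ∑ k : Fin n, |w k|) ^ D := by
  have hW : 0 ≤ ∑ k : Fin n, |w k| := Finset.sum_nonneg fun _ _ => abs_nonneg _
  have hlin : CoeffBd (∑ k : Fin n, MvPolynomial.C (w k) * MvPolynomial.X k)
      (∑ k : Fin n, |w k|) := by
    refine CoeffBd.sum _ _ _ fun k _ => ?_
    rw [MvPolynomial.C_mul_X_eq_monomial]
    exact CoeffBd.monomial _ _
  have hp := CoeffBd.sum (Finset.univ : Finset (Fin (D + 1))) _ _
    fun i _ => (CoeffBd.monomial (n := n) 0 (a i)).mul (hlin.pow (i : ℕ))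
  refine (hp _).trans ?_
  refine (Real.sum_mul_le_sqrt_mul_sqrt _ _ _).trans ?_
  simp only [sq_abs]
  refine mul_le_mul_of_nonneg_left ?_ (Real.sqrt_nonneg _)
  exact Real.sqrt_le_iff.mpr ⟨by positivity, geom_sq_bound _ hW D⟩
end
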